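/- Suppose P(|G| ≤ t) = O(t) as t → 0 and E[G²] < ∞. Then for every q ∈ (1,2): lim_{σ → 0} (R_q(χ*_q(σ), σ) − 1)/σ^{2q−2} = −(1−ε)²·(E|Z|^q)² / (ε·E|G|^{2q−2}). -/

import Mathlib

open MeasureTheory ProbabilityTheory Real Filter Set Asymptotics

noncomputable section

/-- The standard Gaussian measure on `ℝ`. -/
def stdGaussian : Measure ℝ := gaussianReal 0 1

/-- `IsProx q χ u v` : `v` minimizes `z ↦ (1/2)(u−z)² + χ|z|^q`,
i.e. `v = η_q(u;χ)` is the proximal operator of `χ|·|^q` at `u`. -/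
def IsProx (q χ u v : ℝ) : Prop :=
  ∀ z : ℝ, (1/2) * (u - v)^2 + χ * |v| ^ q ≤ (1/2) * (u - z)^2 + χ * |z| ^ q

/-- The law of `B`: the mixture `(1−ε)δ₀ + ε·g`. -/
def mix (ε : ℝ) (g : Measure ℝ) : Measure ℝ :=
  ENNReal.ofReal (1 - ε) • Measure.dirac (0:ℝ) + ENNReal.ofReal ε • g

/-- `R_q(χ,σ) = E[(η(B/σ+Z;χ) − B/σ)²]` with `B ~ μB`, `Z ~ N(0,1)` independent. -/
def Rq (η : ℝ → ℝ → ℝ) (μB : Measure ℝ) (χ σ : ℝ) : ℝ :=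
  ∫ b, (∫ z, (η (b/σ + z) χ - b/σ)^2 ∂stdGaussian) ∂μB

/-- The signed power `sign s * |s| ^ r`. -/
def signedPow (r s : ℝ) : ℝ := (max s 0) ^ r - (max (-s) 0) ^ r

theorem signedPow_of_nonneg {r s : ℝ} (hr : 0 < r) (hs : 0 ≤ s) : signedPow r s = s ^ r := by
  simp [signedPow, hs, zero_rpow hr.ne']

theorem signedPow_neg (r s : ℝ) : signedPow r (-s) = -signedPow r s := by
  simp [signedPow]

theorem signedPow_zero {r : ℝ} : signedPow r 0 = 0 := by
  simp [signedPow]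

theorem continuous_signedPow {r : ℝ} (hr : 0 < r) : Continuous (signedPow r) := by
  unfold signedPow
  exact ((continuous_id.max continuous_const).rpow_const fun _ => Or.inr hr.le).sub
    ((continuous_neg.max continuous_const).rpow_const fun _ => Or.inr hr.le)

theorem monotone_signedPow {r : ℝ} (hr : 0 < r) : Monotone (signedPow r) := by
  intro s t hst
  unfold signedPow
  have h1 : (max s 0) ^ r ≤ (max t 0) ^ r :=
    rpow_le_rpow (le_max_right _ _) (max_le_max_right 0 hst) hr.le
  have h2 : (max (-t) 0) ^ r ≤ (max (-s) 0) ^ r :=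
    rpow_le_rpow (le_max_right _ _) (max_le_max_right 0 (neg_le_neg hst)) hr.le
  linarith

theorem abs_signedPow {r : ℝ} (hr : 0 < r) (s : ℝ) : |signedPow r s| = |s| ^ r := by
  rcases le_total 0 s with h | h
  · rw [signedPow_of_nonneg hr h, abs_of_nonneg h, abs_of_nonneg (rpow_nonneg h _)]
  · have h' : 0 ≤ -s := by linarith
    rw [← abs_neg (signedPow r s), ← signedPow_neg, signedPow_of_nonneg hr h', abs_of_nonpos h,
      abs_of_nonneg (rpow_nonneg h' _)]

theorem self_mul_signedPow {r : ℝ} (hr : 0 < r) (s : ℝ) : s * signedPow r s = |s| ^ (r + 1) := by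
  have key : ∀ s : ℝ, 0 ≤ s → s * signedPow r s = |s| ^ (r + 1) := by
    intro s h
    rw [signedPow_of_nonneg hr h, abs_of_nonneg h, rpow_add_one' h (by linarith), mul_comm]
  rcases le_total 0 s with h | h
  · exact key s h
  · have := key (-s) (by linarith)
    rw [signedPow_neg, abs_neg] at this
    linarith

theorem abs_rpow_mul_self_eq_signedPow {r : ℝ} (hr : 0 < r) (s : ℝ) :
    |s| ^ (r - 1) * s = signedPow r s := by
  rcases eq_or_ne s 0 with rfl | h0
  · simp [signedPow_zero]
  rcases le_total 0 s with h | h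
  · rw [signedPow_of_nonneg hr h, abs_of_nonneg h, rpow_sub_one h0, div_mul_cancel₀ _ h0]
  · have h' : 0 ≤ -s := by linarith
    rw [← neg_neg s, signedPow_neg, signedPow_of_nonneg hr h', abs_neg, abs_of_nonneg h', mul_neg,
      rpow_sub_one (neg_ne_zero.2 h0), div_mul_cancel₀ _ (neg_ne_zero.2 h0)]

theorem abs_signedPow_sub_le {r s : ℝ} (hr : 0 < r) (hr1 : r ≤ 1) (hs : s ≠ 0) (t : ℝ) :
    |signedPow r s - signedPow r t| ≤ 2 * (|s| ^ (r - 1) * |s - t|) := by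
  have pos : ∀ s t : ℝ, 0 < s →
      |signedPow r s - signedPow r t| ≤ 2 * (|s| ^ (r - 1) * |s - t|) := by
    intro s t hs
    have hc : 0 < s ^ (r - 1) := rpow_pos_of_pos hs _
    have split : ∀ x : ℝ, 0 < x → x ^ r = x ^ (r - 1) * x := fun x hx => by
      rw [rpow_sub_one hx.ne', div_mul_cancel₀ _ hx.ne']
    have upper : ∀ x : ℝ, s ≤ x → x ^ r ≤ s ^ (r - 1) * x := fun x hx => by
      rw [split x (hs.trans_le hx)]
      exact mul_le_mul_of_nonneg_right (rpow_le_rpow_of_nonpos hs hx (by linarith))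
        (hs.le.trans hx)
    rw [signedPow_of_nonneg hr hs.le, abs_of_pos hs]
    rcases le_or_gt 0 t with ht | ht
    · rw [signedPow_of_nonneg hr ht]
      rcases le_total s t with hst | hst
      · have h1 := rpow_le_rpow hs.le hst hr.le
        rw [abs_of_nonpos (by linarith), abs_of_nonpos (by linarith)]
        have h2 := upper t hst
        have h3 := split s hs
        nlinarith [mul_nonneg hc.le (sub_nonneg.2 hst)]
      · have h1 := rpow_le_rpow ht hst hr.le
        rw [abs_of_nonneg (by linarith), abs_of_nonneg (by linarith)]
        have h3 := split s hs
        have h2 : s ^ (r - 1) * t ≤ t ^ r := by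
          rcases ht.eq_or_lt with rfl | ht
          · simp [zero_rpow hr.ne']
          · rw [split t ht]
            exact mul_le_mul_of_nonneg_right (rpow_le_rpow_of_nonpos ht hst (by linarith)) ht.le
        nlinarith [mul_nonneg hc.le (sub_nonneg.2 hst)]
    · have ht' : 0 ≤ -t := by linarith
      have e : signedPow r t = -(-t) ^ r := by
        rw [← signedPow_of_nonneg hr ht', signedPow_neg, neg_neg]
      have h0 : 0 ≤ s ^ r := rpow_nonneg hs.le _
      have h1 : 0 ≤ (-t) ^ r := rpow_nonneg ht' _
      rw [e, abs_of_nonneg (by linarith), abs_of_nonneg (by linarith)]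
      have h3 := split s hs
      have h4 : 0 ≤ s ^ (r - 1) * (-t) := mul_nonneg hc.le ht'
      rcases le_total s (-t) with hst | hst
      · have h2 := upper (-t) hst
        nlinarith
      · have h2 := rpow_le_rpow ht' hst hr.le
        nlinarith
  rcases hs.lt_or_gt with h | h
  · have := pos (-s) (-t) (by linarith)
    rw [signedPow_neg, signedPow_neg, abs_neg, neg_sub_neg, neg_sub_neg] at this
    rwa [abs_sub_comm, abs_sub_comm s]
  · exact pos s t h

theorem abs_signedPow_sub_le_rpow {r : ℝ} (hr : 0 < r) (hr1 : r ≤ 1) (s t : ℝ) :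
    |signedPow r s - signedPow r t| ≤ 2 * |s - t| ^ r := by
  have h0 : 0 ≤ |s - t| ^ r := rpow_nonneg (abs_nonneg _) _
  rcases eq_or_ne s t with rfl | hne
  · simpa using h0
  have hd : 0 < |s - t| := abs_pos.2 (sub_ne_zero.2 hne)
  rcases le_or_gt |s| |s - t| with h1 | h1
  · rcases le_or_gt |t| |s - t| with h2 | h2
    · calc |signedPow r s - signedPow r t| ≤ |signedPow r s| + |signedPow r t| := abs_sub _ _
        _ = |s| ^ r + |t| ^ r := by rw [abs_signedPow hr, abs_signedPow hr]
        _ ≤ |s - t| ^ r + |s - t| ^ r := add_le_add (rpow_le_rpow (abs_nonneg _) h1 hr.le)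
            (rpow_le_rpow (abs_nonneg _) h2 hr.le)
        _ = 2 * |s - t| ^ r := by ring
    · have ht : t ≠ 0 := by rintro rfl; simp at h2; linarith [abs_nonneg s]
      have := abs_signedPow_sub_le hr hr1 ht s
      rw [abs_sub_comm, abs_sub_comm t s] at this
      refine this.trans ?_
      have h3 := rpow_le_rpow_of_nonpos hd h2.le (by linarith : r - 1 ≤ 0)
      have h4 := mul_le_mul_of_nonneg_right h3 hd.le
      rw [rpow_sub_one hd.ne' r, div_mul_cancel₀ _ hd.ne'] at h4
      linarith
  · have hs : s ≠ 0 := by rintro rfl; simp at h1; linarith [abs_nonneg t]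
    refine (abs_signedPow_sub_le hr hr1 hs t).trans ?_
    have h3 := rpow_le_rpow_of_nonpos hd h1.le (by linarith : r - 1 ≤ 0)
    have h4 := mul_le_mul_of_nonneg_right h3 hd.le
    rw [rpow_sub_one hd.ne' r, div_mul_cancel₀ _ hd.ne'] at h4
    linarith

/-- The first order optimality condition of the proximal operator. -/
theorem IsProx.add_signedPow_eq {q χ u v : ℝ} (hq : 1 < q) (h : IsProx q χ u v) :
    v + χ * q * signedPow (q - 1) v = u := by
  have hd : HasDerivAt (fun z : ℝ => (1/2) * (u - z)^2 + χ * |z| ^ q)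
      ((1/2) * (2 * (u - v) * (-1)) + χ * (q * |v| ^ (q - 2) * v)) v := by
    have h1 : HasDerivAt (fun z : ℝ => u - z) (-1) v := by
      simpa using (hasDerivAt_id v).const_sub u
    have h2 := (h1.pow 2).const_mul (1/2 : ℝ)
    have h3 := (hasDerivAt_abs_rpow v hq).const_mul χ
    exact (h2.add h3).congr_deriv (by norm_num)
  have hmin : IsLocalMin (fun z : ℝ => (1/2) * (u - z)^2 + χ * |z| ^ q) v :=
    Eventually.of_forall h
  have h0 := hmin.hasDerivAt_eq_zero hd
  have e := abs_rpow_mul_self_eq_signedPow (r := q - 1) (by linarith) v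
  rw [show q - 1 - 1 = q - 2 by ring] at e
  rw [← e]
  linarith

theorem abs_sub_le_of_add_signedPow_eq {r c u₁ u₂ v₁ v₂ : ℝ} (hr : 0 < r) (hc : 0 ≤ c)
    (h₁ : v₁ + c * signedPow r v₁ = u₁) (h₂ : v₂ + c * signedPow r v₂ = u₂) :
    |v₁ - v₂| ≤ |u₁ - u₂| := by
  rcases le_total v₁ v₂ with h | h
  · have := mul_le_mul_of_nonneg_left (monotone_signedPow hr h) hc
    rw [abs_of_nonpos (by linarith), abs_of_nonpos (by linarith)]
    linarith
  · have := mul_le_mul_of_nonneg_left (monotone_signedPow hr h) hc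
    rw [abs_of_nonneg (by linarith), abs_of_nonneg (by linarith)]
    linarith

theorem abs_add_mul_rpow_eq {r c u v : ℝ} (hr : 0 < r) (hc : 0 ≤ c)
    (h : v + c * signedPow r v = u) : |v| + c * |v| ^ r = |u| := by
  rw [← h, ← abs_signedPow hr]
  rcases le_total 0 v with hv | hv
  · have h1 : 0 ≤ signedPow r v := signedPow_zero (r := r) ▸ monotone_signedPow hr hv
    rw [abs_of_nonneg hv, abs_of_nonneg h1, abs_of_nonneg (by positivity)]
  · have h1 : signedPow r v ≤ 0 := signedPow_zero (r := r) ▸ monotone_signedPow hr hv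
    have := mul_nonpos_of_nonneg_of_nonpos hc h1
    rw [abs_of_nonpos hv, abs_of_nonpos h1, abs_of_nonpos (by linarith)]
    ring

/-- The displacement `c * |v| ^ r` of the proximal operator grows with the parameter `c`. -/
theorem mul_rpow_mono_of_add_signedPow_eq {r c d u v w : ℝ} (hr : 0 < r) (hc : 0 ≤ c)
    (hcd : c ≤ d) (hv : v + c * signedPow r v = u) (hw : w + d * signedPow r w = u) :
    c * |v| ^ r ≤ d * |w| ^ r := by
  have h1 := abs_add_mul_rpow_eq hr hc hv
  have h2 := abs_add_mul_rpow_eq hr (hc.trans hcd) hw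
  by_contra! hlt
  have h3 : |v| < |w| := by linarith
  have h4 := rpow_le_rpow (abs_nonneg v) h3.le hr.le
  have h5 : c * |v| ^ r ≤ d * |w| ^ r :=
    mul_le_mul hcd h4 (rpow_nonneg (abs_nonneg _) _) (hc.trans hcd)
  linarith

instance isProbabilityMeasure_stdGaussian : IsProbabilityMeasure stdGaussian := by
  unfold _root_.stdGaussian; infer_instance

theorem memLp_id_stdGaussian : MemLp (fun z : ℝ => z) 2 stdGaussian :=
  memLp_id_gaussianReal 2

theorem integral_id_stdGaussian : ∫ z, z ∂stdGaussian = 0 :=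
  integral_id_gaussianReal

theorem integral_sq_stdGaussian : ∫ z, z ^ 2 ∂stdGaussian = 1 := by
  have h := variance_fun_id_gaussianReal (μ := 0) (v := 1)
  rwa [variance_of_integral_eq_zero measurable_id'.aemeasurable integral_id_gaussianReal] at h

theorem rpow_le_one_add_sq {x s : ℝ} (hx : 0 ≤ x) (hs0 : 0 ≤ s) (hs : s ≤ 2) :
    x ^ s ≤ 1 + x ^ 2 := by
  rcases le_total x 1 with h | h
  · have := rpow_le_one hx h hs0
    nlinarith [sq_nonneg x]
  · have := rpow_le_rpow_of_exponent_le h hs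
    rw [rpow_two] at this
    linarith

section Risk

variable {q : ℝ} {η : ℝ → ℝ → ℝ} {μ : Measure ℝ} [IsProbabilityMeasure μ]

theorem continuous_prox (hq1 : 1 < q) (hη : ∀ u χ, 0 ≤ χ → IsProx q χ u (η u χ)) {χ : ℝ}
    (hχ : 0 ≤ χ) : Continuous fun u => η u χ := by
  refine (LipschitzWith.of_dist_le_mul (K := 1) fun u v => ?_).continuous
  have hq0 : 0 ≤ χ * q := mul_nonneg hχ (by linarith)
  simpa [Real.dist_eq] using abs_sub_le_of_add_signedPow_eq (by linarith) hq0
    (hη u χ hχ |>.add_signedPow_eq hq1) (hη v χ hχ |>.add_signedPow_eq hq1)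

theorem abs_prox_le (hq1 : 1 < q) (hη : ∀ u χ, 0 ≤ χ → IsProx q χ u (η u χ)) {χ : ℝ}
    (hχ : 0 ≤ χ) (u : ℝ) : |η u χ| ≤ |u| := by
  have hq0 : 0 ≤ χ * q := mul_nonneg hχ (by linarith)
  have h := abs_add_mul_rpow_eq (by linarith) hq0 (hη u χ hχ |>.add_signedPow_eq hq1)
  linarith [mul_nonneg hq0 (rpow_nonneg (abs_nonneg (η u χ)) (q - 1))]

theorem signedPow_sq {r : ℝ} (hr : 0 < r) (s : ℝ) : signedPow r s ^ 2 = |s| ^ (2 * r) := by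
  rw [← sq_abs, abs_signedPow hr, mul_comm, rpow_mul (abs_nonneg _), rpow_two]

theorem integrable_prod_sq_add_sq (hμ : Integrable (fun x : ℝ => x ^ 2) μ) (a b c : ℝ) :
    Integrable (fun p : ℝ × ℝ => a + b * p.1 ^ 2 + c * p.2 ^ 2) (μ.prod stdGaussian) :=
  ((integrable_const a).add ((hμ.comp_fst stdGaussian).const_mul b)).add
    ((memLp_id_stdGaussian.integrable_sq.comp_snd μ).const_mul c)

theorem memLp_snd : MemLp (fun p : ℝ × ℝ => p.2) 2 (μ.prod stdGaussian) :=
  memLp_id_stdGaussian.comp_snd μ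

theorem integral_snd_sq : ∫ p : ℝ × ℝ, p.2 ^ 2 ∂(μ.prod stdGaussian) = 1 := by
  rw [integral_fun_snd (fun z : ℝ => z ^ 2), integral_sq_stdGaussian]; simp

theorem memLp_signedPow_prox (hq1 : 1 < q) (hq2 : q < 2)
    (hη : ∀ u χ, 0 ≤ χ → IsProx q χ u (η u χ)) (hμ : Integrable (fun x : ℝ => x ^ 2) μ)
    {χ : ℝ} (hχ : 0 ≤ χ) (σ c : ℝ) :
    MemLp (fun p : ℝ × ℝ => signedPow (q - 1) (η (p.1 / σ + c * p.2) χ)) 2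
      (μ.prod stdGaussian) := by
  have hr : 0 < q - 1 := by linarith
  have hcont : Continuous fun p : ℝ × ℝ => signedPow (q - 1) (η (p.1 / σ + c * p.2) χ) :=
    (continuous_signedPow hr).comp ((continuous_prox hq1 hη hχ).comp (by fun_prop))
  rw [memLp_two_iff_integrable_sq hcont.aestronglyMeasurable]
  refine (integrable_prod_sq_add_sq hμ 1 (2 * (σ⁻¹) ^ 2) (2 * c ^ 2)).mono'
    (hcont.pow 2).aestronglyMeasurable (Eventually.of_forall fun p => ?_)
  rw [Real.norm_eq_abs, abs_of_nonneg (sq_nonneg _), signedPow_sq hr]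
  have h1 := rpow_le_rpow (abs_nonneg _) (abs_prox_le hq1 hη hχ (p.1 / σ + c * p.2))
    (by linarith : 0 ≤ 2 * (q - 1))
  have h2 := rpow_le_one_add_sq (abs_nonneg (p.1 / σ + c * p.2))
    (by linarith : 0 ≤ 2 * (q - 1)) (by linarith)
  rw [sq_abs] at h2
  rw [div_eq_mul_inv] at *
  nlinarith [sq_nonneg (p.1 * σ⁻¹ - c * p.2)]

/-- Expansion of the risk in the displacement `χ * q * signedPow (q - 1) (η u χ)`. -/
theorem Rq_eq (hq1 : 1 < q) (hq2 : q < 2) (hη : ∀ u χ, 0 ≤ χ → IsProx q χ u (η u χ))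
    (hμ : Integrable (fun x : ℝ => x ^ 2) μ) {χ : ℝ} (hχ : 0 ≤ χ) (σ : ℝ) :
    Rq η μ χ σ = 1
      + (χ * q) ^ 2 * ∫ p, signedPow (q - 1) (η (p.1 / σ + p.2) χ) ^ 2 ∂(μ.prod stdGaussian)
      - 2 * (χ * q) *
        ∫ p, p.2 * signedPow (q - 1) (η (p.1 / σ + p.2) χ) ∂(μ.prod stdGaussian) := by
  have hF := memLp_signedPow_prox hq1 hq2 hη hμ hχ σ 1
  simp only [one_mul] at hF
  have hsq := hF.integrable_sq.const_mul ((χ * q) ^ 2)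
  have hmul := (memLp_snd.integrable_mul hF).const_mul (2 * (χ * q))
  simp only [Pi.mul_apply] at hmul
  have hz := (memLp_snd (μ := μ)).integrable_sq
  have hpt : ∀ p : ℝ × ℝ, (η (p.1 / σ + p.2) χ - p.1 / σ) ^ 2 =
      p.2 ^ 2 + (χ * q) ^ 2 * signedPow (q - 1) (η (p.1 / σ + p.2) χ) ^ 2
        - 2 * (χ * q) * (p.2 * signedPow (q - 1) (η (p.1 / σ + p.2) χ)) := by
    intro p
    have h := (hη (p.1 / σ + p.2) χ hχ).add_signedPow_eq hq1
    have h' : η (p.1 / σ + p.2) χ - p.1 / σ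
        = p.2 - χ * q * signedPow (q - 1) (η (p.1 / σ + p.2) χ) := by linarith
    rw [h']; ring
  have hrisk : Integrable (fun p : ℝ × ℝ => (η (p.1 / σ + p.2) χ - p.1 / σ) ^ 2)
      (μ.prod stdGaussian) := by
    simp only [hpt]
    exact (hz.add hsq).sub hmul
  calc Rq η μ χ σ
      = ∫ p : ℝ × ℝ, (η (p.1 / σ + p.2) χ - p.1 / σ) ^ 2 ∂(μ.prod stdGaussian) :=
        (integral_prod _ hrisk).symm
    _ = _ := by
        have e := integral_sub (hz.add hsq) hmul
        simp only [Pi.add_apply] at e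
        simp only [hpt]
        rw [e, integral_add hz hsq, integral_const_mul, integral_const_mul, integral_snd_sq]

theorem tendsto_integral_signedPow_prox_sq (hq1 : 1 < q) (hq2 : q < 2)
    (hη : ∀ u χ, 0 ≤ χ → IsProx q χ u (η u χ)) (hμ : Integrable (fun x : ℝ => x ^ 2) μ)
    {χ : ℝ → ℝ} (hχ : ∀ᶠ σ in nhdsWithin (0:ℝ) (Ioi 0), 0 ≤ χ σ ∧ χ σ ≤ 1) :
    Tendsto (fun σ => σ ^ (2 * q - 2) *
        ∫ p, signedPow (q - 1) (η (p.1 / σ + p.2) (χ σ)) ^ 2 ∂(μ.prod stdGaussian))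
      (nhdsWithin (0:ℝ) (Ioi 0)) (nhds (∫ x, |x| ^ (2 * q - 2) ∂μ)) := by
  have hr : 0 < q - 1 := by linarith
  have hσ : ∀ᶠ σ in nhdsWithin (0:ℝ) (Ioi 0), 0 < σ ∧ σ < 1 :=
    Ioo_mem_nhdsGT one_pos
  have hexp : 0 < 2 * q - 2 := by linarith
  have hlim : ∫ p : ℝ × ℝ, |p.1| ^ (2 * q - 2) ∂(μ.prod stdGaussian)
      = ∫ x, |x| ^ (2 * q - 2) ∂μ := by
    rw [integral_fun_fst (fun x : ℝ => |x| ^ (2 * q - 2))]; simp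
  rw [← hlim]
  have hpt : ∀ σ u : ℝ, ∀ d : ℝ, 0 < σ → σ ^ (2 * q - 2) * signedPow (q - 1) (η u d) ^ 2
      = |σ * η u d| ^ (2 * q - 2) := by
    intro σ u d h
    rw [signedPow_sq hr, abs_mul, abs_of_pos h, mul_rpow h.le (abs_nonneg _)]
    ring_nf
  simp only [← integral_const_mul]
  refine tendsto_integral_filter_of_dominated_convergence
    (fun p : ℝ × ℝ => 1 + 2 * p.1 ^ 2 + 2 * p.2 ^ 2) ?_ ?_
    (integrable_prod_sq_add_sq hμ 1 2 2) (Eventually.of_forall fun p => ?_)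
  · filter_upwards [hχ] with σ h
    have := memLp_signedPow_prox hq1 hq2 hη hμ h.1 σ 1
    simp only [one_mul] at this
    exact (this.integrable_sq.const_mul _).aestronglyMeasurable
  · filter_upwards [hχ, hσ] with σ h hs
    refine Eventually.of_forall fun p => ?_
    rw [hpt _ _ _ hs.1, Real.norm_eq_abs, abs_of_nonneg (rpow_nonneg (abs_nonneg _) _)]
    have h1 : |σ * η (p.1 / σ + p.2) (χ σ)| ≤ |p.1 + σ * p.2| := by
      have e : p.1 + σ * p.2 = σ * (p.1 / σ + p.2) := by
        rw [mul_add, mul_div_cancel₀ _ hs.1.ne']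
      rw [e, abs_mul, abs_mul]
      exact mul_le_mul_of_nonneg_left (abs_prox_le hq1 hη h.1 _) (abs_nonneg _)
    refine (rpow_le_rpow (abs_nonneg _) h1 hexp.le).trans
      ((rpow_le_one_add_sq (abs_nonneg _) hexp.le (by linarith)).trans ?_)
    rw [sq_abs]
    have h2 : σ ^ 2 * p.2 ^ 2 ≤ 1 * p.2 ^ 2 :=
      mul_le_mul_of_nonneg_right (by nlinarith [hs.1, hs.2]) (sq_nonneg _)
    nlinarith [sq_nonneg (p.1 - σ * p.2)]
  · have hu : Tendsto (fun σ : ℝ => |p.1 + σ * p.2|) (nhdsWithin (0:ℝ) (Ioi 0))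
        (nhds |p.1|) := by
      have : Continuous fun σ : ℝ => |p.1 + σ * p.2| := by fun_prop
      simpa using (this.tendsto 0).mono_left nhdsWithin_le_nhds
    have hpow : Tendsto (fun σ : ℝ => q * (σ ^ (2 - q) * |p.1 + σ * p.2| ^ (q - 1)))
        (nhdsWithin (0:ℝ) (Ioi 0)) (nhds 0) := by
      have h1 : Tendsto (fun σ : ℝ => σ ^ (2 - q)) (nhdsWithin (0:ℝ) (Ioi 0)) (nhds 0) := by
        have := (continuous_rpow_const (by linarith : 0 ≤ 2 - q)).tendsto (0:ℝ)
        rw [zero_rpow (by linarith)] at this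
        exact this.mono_left nhdsWithin_le_nhds
      simpa using (h1.mul (hu.rpow_const (Or.inr hr.le))).const_mul q
    have hη' : Tendsto (fun σ : ℝ => |σ * η (p.1 / σ + p.2) (χ σ)|)
        (nhdsWithin (0:ℝ) (Ioi 0)) (nhds |p.1|) := by
      have hlow := hu.sub hpow
      rw [sub_zero] at hlow
      refine tendsto_of_tendsto_of_tendsto_of_le_of_le' hlow hu ?_ ?_
      all_goals
        filter_upwards [hχ, hσ] with σ h hs
        have e : p.1 + σ * p.2 = σ * (p.1 / σ + p.2) := by
          rw [mul_add, mul_div_cancel₀ _ hs.1.ne']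
        have hle := abs_prox_le hq1 hη h.1 (p.1 / σ + p.2)
        rw [e, abs_mul, abs_mul, abs_of_pos hs.1]
      · have h1 := abs_add_mul_rpow_eq hr (mul_nonneg h.1 (by linarith))
          ((hη (p.1 / σ + p.2) (χ σ) h.1).add_signedPow_eq hq1)
        have h2 : σ ^ (2 - q) * (σ * |p.1 / σ + p.2|) ^ (q - 1)
            = σ * |p.1 / σ + p.2| ^ (q - 1) := by
          rw [mul_rpow hs.1.le (abs_nonneg _), ← mul_assoc, ← rpow_add hs.1]
          norm_num
        have h3 := rpow_le_rpow (abs_nonneg _) hle hr.le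
        have h4 : χ σ * q * |η (p.1 / σ + p.2) (χ σ)| ^ (q - 1)
            ≤ q * |p.1 / σ + p.2| ^ (q - 1) :=
          mul_le_mul (by nlinarith [h.2]) h3 (rpow_nonneg (abs_nonneg _) _) (by linarith)
        rw [h2]
        nlinarith [mul_le_mul_of_nonneg_left h4 hs.1.le]
      · exact mul_le_mul_of_nonneg_left hle hs.1.le
    refine (hη'.rpow_const (Or.inr hexp.le)).congr' ?_
    filter_upwards [hσ] with σ hs
    rw [hpt _ _ _ hs.1]

theorem integral_snd_mul_eq (hq1 : 1 < q) (hq2 : q < 2)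
    (hη : ∀ u χ, 0 ≤ χ → IsProx q χ u (η u χ)) (hμ : Integrable (fun x : ℝ => x ^ 2) μ)
    {χ : ℝ} (hχ : 0 ≤ χ) (σ : ℝ) :
    ∫ p, p.2 * signedPow (q - 1) (η (p.1 / σ + p.2) χ) ∂(μ.prod stdGaussian)
      = ∫ p, p.2 * (signedPow (q - 1) (η (p.1 / σ + p.2) χ) - signedPow (q - 1) (η (p.1 / σ) χ))
        ∂(μ.prod stdGaussian) := by
  have h1 := memLp_signedPow_prox hq1 hq2 hη hμ hχ σ 1
  have h0 := memLp_signedPow_prox hq1 hq2 hη hμ hχ σ 0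
  simp only [one_mul, zero_mul, add_zero] at h1 h0
  have i1 : Integrable (fun p : ℝ × ℝ => p.2 * signedPow (q - 1) (η (p.1 / σ + p.2) χ))
      (μ.prod stdGaussian) := memLp_snd.integrable_mul h1
  have i0 : Integrable (fun p : ℝ × ℝ => p.2 * signedPow (q - 1) (η (p.1 / σ) χ))
      (μ.prod stdGaussian) := memLp_snd.integrable_mul h0
  have hzero : ∫ p, p.2 * signedPow (q - 1) (η (p.1 / σ) χ) ∂(μ.prod stdGaussian) = 0 := by
    have := integral_prod_mul (μ := μ) (ν := stdGaussian)
      (fun x : ℝ => signedPow (q - 1) (η (x / σ) χ)) (fun z : ℝ => z)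
    rw [integral_id_stdGaussian, mul_zero] at this
    simpa only [mul_comm] using this
  simp_rw [mul_sub]
  rw [integral_sub i1 i0, hzero, sub_zero]

theorem tendsto_integral_snd_mul_signedPow_prox (hq1 : 1 < q) (hq2 : q < 2)
    (hη : ∀ u χ, 0 ≤ χ → IsProx q χ u (η u χ)) (hμ : Integrable (fun x : ℝ => x ^ 2) μ)
    {χ : ℝ → ℝ} (hχ : ∀ᶠ σ in nhdsWithin (0:ℝ) (Ioi 0), 0 ≤ χ σ)
    (hχ0 : Tendsto χ (nhdsWithin (0:ℝ) (Ioi 0)) (nhds 0)) :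
    Tendsto (fun σ => ∫ p, p.2 * signedPow (q - 1) (η (p.1 / σ + p.2) (χ σ))
        ∂(μ.prod stdGaussian))
      (nhdsWithin (0:ℝ) (Ioi 0)) (nhds (μ.real {0} * ∫ z, |z| ^ q ∂stdGaussian)) := by
  have hr : 0 < q - 1 := by linarith
  have hlim : ∫ p : ℝ × ℝ, ({0} : Set ℝ).indicator (fun _ => (1:ℝ)) p.1 * |p.2| ^ q
      ∂(μ.prod stdGaussian) = μ.real {0} * ∫ z, |z| ^ q ∂stdGaussian := by
    rw [integral_prod_mul (({0} : Set ℝ).indicator (fun _ => (1:ℝ))) (fun z : ℝ => |z| ^ q),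
      integral_indicator_const _ (measurableSet_singleton 0)]
    simp
  rw [← hlim]
  have hcongr : (fun σ => ∫ p, p.2 * (signedPow (q - 1) (η (p.1 / σ + p.2) (χ σ))
        - signedPow (q - 1) (η (p.1 / σ) (χ σ))) ∂(μ.prod stdGaussian))
      =ᶠ[nhdsWithin (0:ℝ) (Ioi 0)] fun σ => ∫ p, p.2 * signedPow (q - 1)
        (η (p.1 / σ + p.2) (χ σ)) ∂(μ.prod stdGaussian) := by
    filter_upwards [hχ] with σ h
    exact (integral_snd_mul_eq hq1 hq2 hη hμ h σ).symm
  refine Tendsto.congr' hcongr ?_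
  have hlip : ∀ u v c : ℝ, 0 ≤ c → |η u c - η v c| ≤ |u - v| := fun u v c hc =>
    abs_sub_le_of_add_signedPow_eq hr (mul_nonneg hc (by linarith))
      (hη u c hc |>.add_signedPow_eq hq1) (hη v c hc |>.add_signedPow_eq hq1)
  refine tendsto_integral_filter_of_dominated_convergence
    (fun p : ℝ × ℝ => 2 + 0 * p.1 ^ 2 + 2 * p.2 ^ 2) ?_ ?_
    (integrable_prod_sq_add_sq hμ 2 0 2) (Eventually.of_forall fun p => ?_)
  · filter_upwards [hχ] with σ h
    have hc := (continuous_signedPow hr).comp (continuous_prox hq1 hη h)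
    have h1 : Continuous fun p : ℝ × ℝ => p.2 * (signedPow (q - 1) (η (p.1 / σ + p.2) (χ σ))
        - signedPow (q - 1) (η (p.1 / σ) (χ σ))) :=
      continuous_snd.mul ((hc.comp (by fun_prop : Continuous fun p : ℝ × ℝ => p.1 / σ + p.2)).sub
        (hc.comp (by fun_prop : Continuous fun p : ℝ × ℝ => p.1 / σ)))
    exact h1.aestronglyMeasurable
  · filter_upwards [hχ] with σ h
    refine Eventually.of_forall fun p => ?_
    rw [Real.norm_eq_abs, abs_mul]
    have h1 := abs_signedPow_sub_le_rpow hr (by linarith) (η (p.1 / σ + p.2) (χ σ))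
      (η (p.1 / σ) (χ σ))
    have h2 := hlip (p.1 / σ + p.2) (p.1 / σ) (χ σ) h
    rw [add_sub_cancel_left] at h2
    have h3 := rpow_le_rpow (abs_nonneg _) h2 hr.le
    have h4 : |p.2| * |p.2| ^ (q - 1) = |p.2| ^ q := by
      rw [mul_comm, ← rpow_add_one' (abs_nonneg _) (by linarith), sub_add_cancel]
    have h5 := rpow_le_one_add_sq (abs_nonneg p.2) (by linarith : 0 ≤ q) hq2.le
    rw [sq_abs] at h5
    nlinarith [mul_le_mul_of_nonneg_left (h1.trans (mul_le_mul_of_nonneg_left h3 zero_le_two))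
      (abs_nonneg p.2)]
  · obtain ⟨b, z⟩ := p
    rcases eq_or_ne b 0 with rfl | hb
    · have h0 : ∀ c, 0 ≤ c → η 0 c = 0 := fun c hc => by
        simpa using abs_prox_le hq1 hη hc 0
      have hηz : Tendsto (fun σ => η z (χ σ)) (nhdsWithin (0:ℝ) (Ioi 0)) (nhds z) := by
        rw [tendsto_iff_dist_tendsto_zero]
        have hbd : Tendsto (fun σ => χ σ * q * |z| ^ (q - 1)) (nhdsWithin (0:ℝ) (Ioi 0))
            (nhds 0) := by
          simpa using (hχ0.mul_const q).mul_const (|z| ^ (q - 1))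
        refine squeeze_zero' (Eventually.of_forall fun _ => dist_nonneg) ?_ hbd
        filter_upwards [hχ] with σ h
        have e := (hη z (χ σ) h).add_signedPow_eq hq1
        have hc : 0 ≤ χ σ * q := mul_nonneg h (by linarith)
        rw [Real.dist_eq, show η z (χ σ) - z
          = -(χ σ * q * signedPow (q - 1) (η z (χ σ))) by linarith, abs_neg, abs_mul,
          abs_of_nonneg hc, abs_signedPow hr]
        exact mul_le_mul_of_nonneg_left
          (rpow_le_rpow (abs_nonneg _) (abs_prox_le hq1 hη h z) hr.le) hc
      have hT := (((continuous_signedPow hr).tendsto z).comp hηz).const_mul z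
      rw [self_mul_signedPow hr, sub_add_cancel] at hT
      simp only [mem_singleton_iff, indicator_of_mem, one_mul]
      refine hT.congr' ?_
      filter_upwards [hχ] with σ h
      simp [h0 _ h, signedPow_zero]
    · have hind : ({0} : Set ℝ).indicator (fun _ => (1:ℝ)) b * |z| ^ q = 0 := by
        simp [hb]
      have hu : Tendsto (fun σ : ℝ => |b / σ|) (nhdsWithin (0:ℝ) (Ioi 0)) atTop := by
        have h1 : Tendsto (fun σ : ℝ => |b| * σ⁻¹) (nhdsWithin (0:ℝ) (Ioi 0)) atTop :=
          tendsto_inv_nhdsGT_zero.const_mul_atTop (abs_pos.2 hb)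
        refine h1.congr' ?_
        filter_upwards [self_mem_nhdsWithin] with σ hs
        rw [abs_div, abs_of_pos (mem_Ioi.1 hs), div_eq_mul_inv]
      have hηu : Tendsto (fun σ : ℝ => |η (b / σ) (χ σ)|) (nhdsWithin (0:ℝ) (Ioi 0)) atTop := by
        rw [tendsto_atTop]
        intro K
        have hχ1 : ∀ᶠ σ in nhdsWithin (0:ℝ) (Ioi 0), χ σ < 1 :=
          hχ0.eventually_lt_const one_pos
        filter_upwards [hχ, hχ1, tendsto_atTop.1 hu (|K| + q * |K| ^ (q - 1))] with σ h h1 hK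
        by_contra! hlt
        have e := abs_add_mul_rpow_eq hr (mul_nonneg h (by linarith))
          ((hη (b / σ) (χ σ) h).add_signedPow_eq hq1)
        have hlt' := hlt.trans_le (le_abs_self K)
        have h3 := rpow_le_rpow (abs_nonneg _) hlt'.le hr.le
        have h4 : χ σ * q * |η (b / σ) (χ σ)| ^ (q - 1) ≤ q * |K| ^ (q - 1) :=
          mul_le_mul (by nlinarith) h3 (rpow_nonneg (abs_nonneg _) _) (by linarith)
        linarith
      have hdec : Tendsto (fun σ : ℝ => |η (b / σ) (χ σ)| ^ (q - 1 - 1))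
          (nhdsWithin (0:ℝ) (Ioi 0)) (nhds 0) := by
        have := (tendsto_rpow_neg_atTop (by linarith : 0 < 2 - q)).comp hηu
        refine this.congr fun σ => ?_
        simp only [Function.comp_apply]
        ring_nf
      have hbd : Tendsto (fun σ : ℝ => |z| * (2 * (|η (b / σ) (χ σ)| ^ (q - 1 - 1) * |z|)))
          (nhdsWithin (0:ℝ) (Ioi 0)) (nhds 0) := by
        simpa using ((hdec.mul_const |z|).const_mul 2).const_mul |z|
      simp only [hind]
      refine squeeze_zero_norm' ?_ hbd
      filter_upwards [hχ, hηu.eventually_gt_atTop 0] with σ h hpos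
      rw [Real.norm_eq_abs, abs_mul, abs_sub_comm]
      refine mul_le_mul_of_nonneg_left ?_ (abs_nonneg _)
      refine (abs_signedPow_sub_le hr (by linarith) (abs_pos.1 hpos) _).trans ?_
      have h2 := hlip (b / σ) (b / σ + z) (χ σ) h
      rw [sub_add_cancel_left, abs_neg] at h2
      have := rpow_nonneg (abs_nonneg (η (b / σ) (χ σ))) (q - 1 - 1)
      gcongr

/-- A tuning that does not increase the risk above `1` has bounded displacement in `L²`. -/
theorem mul_integral_signedPow_prox_sq_le (hq1 : 1 < q) (hq2 : q < 2)
    (hη : ∀ u χ, 0 ≤ χ → IsProx q χ u (η u χ)) (hμ : Integrable (fun x : ℝ => x ^ 2) μ)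
    {χ δ σ : ℝ} (hδ : 0 ≤ δ) (hδχ : δ ≤ χ) (hR : Rq η μ χ σ ≤ 1) :
    (δ * q) ^ 2 * ∫ p, signedPow (q - 1) (η (p.1 / σ + p.2) δ) ^ 2 ∂(μ.prod stdGaussian)
      ≤ 4 := by
  have hr : 0 < q - 1 := by linarith
  have hχ : 0 ≤ χ := hδ.trans hδχ
  have hF := memLp_signedPow_prox hq1 hq2 hη hμ hχ σ 1
  have hG := memLp_signedPow_prox hq1 hq2 hη hμ hδ σ 1
  simp only [one_mul] at hF hG
  have hsq := hF.integrable_sq.const_mul ((χ * q) ^ 2)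
  have hmul := (memLp_snd.integrable_mul hF).const_mul (2 * (χ * q))
  simp only [Pi.mul_apply] at hmul
  have hz := (memLp_snd (μ := μ)).integrable_sq
  rw [Rq_eq hq1 hq2 hη hμ hχ] at hR
  have h1 : ∫ p, 2 * (χ * q) * (p.2 * signedPow (q - 1) (η (p.1 / σ + p.2) χ))
        ∂(μ.prod stdGaussian)
      ≤ ∫ p, (1/2 * ((χ * q) ^ 2 * signedPow (q - 1) (η (p.1 / σ + p.2) χ) ^ 2)
        + 2 * p.2 ^ 2) ∂(μ.prod stdGaussian) := by
    refine integral_mono hmul ((hsq.const_mul _).add (hz.const_mul 2)) fun p => ?_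
    simp only
    nlinarith [sq_nonneg (χ * q * signedPow (q - 1) (η (p.1 / σ + p.2) χ) - 2 * p.2)]
  rw [integral_add (hsq.const_mul _) (hz.const_mul 2)] at h1
  simp only [integral_const_mul, integral_snd_sq] at h1
  have h2 : ∫ p, (δ * q) ^ 2 * signedPow (q - 1) (η (p.1 / σ + p.2) δ) ^ 2 ∂(μ.prod stdGaussian)
      ≤ ∫ p, (χ * q) ^ 2 * signedPow (q - 1) (η (p.1 / σ + p.2) χ) ^ 2
        ∂(μ.prod stdGaussian) := by
    refine integral_mono (hG.integrable_sq.const_mul _) hsq fun p => ?_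
    have hq0 : 0 ≤ δ * q := mul_nonneg hδ (by linarith)
    have h := mul_rpow_mono_of_add_signedPow_eq hr hq0
      (mul_le_mul_of_nonneg_right hδχ (by linarith : 0 ≤ q))
      ((hη (p.1 / σ + p.2) δ hδ).add_signedPow_eq hq1)
      ((hη (p.1 / σ + p.2) χ hχ).add_signedPow_eq hq1)
    simp only
    rw [← abs_signedPow hr, ← abs_signedPow hr] at h
    have := pow_le_pow_left₀ (mul_nonneg hq0 (abs_nonneg _)) h 2
    simpa only [mul_pow, sq_abs] using this
  simp only [integral_const_mul] at h2
  linarith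

/-- Rate of the optimally tuned risk for an arbitrary signal law with finite second moment. -/
theorem tendsto_Rq_sub_one_div (hq1 : 1 < q) (hq2 : q < 2)
    (hη : ∀ u χ, 0 ≤ χ → IsProx q χ u (η u χ)) (hμ : Integrable (fun x : ℝ => x ^ 2) μ)
    (hM : 0 < ∫ x, |x| ^ (2 * q - 2) ∂μ) {χ : ℝ → ℝ}
    (hχ : ∀ᶠ σ in nhdsWithin (0:ℝ) (Ioi 0),
      0 ≤ χ σ ∧ ∀ c, 0 ≤ c → Rq η μ (χ σ) σ ≤ Rq η μ c σ) :
    Tendsto (fun σ => (Rq η μ (χ σ) σ - 1) / σ ^ (2 * q - 2)) (nhdsWithin (0:ℝ) (Ioi 0))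
      (nhds (-((μ.real {0} * ∫ z, |z| ^ q ∂stdGaussian) ^ 2 / ∫ x, |x| ^ (2 * q - 2) ∂μ))) := by
  set M := ∫ x, |x| ^ (2 * q - 2) ∂μ
  set m := μ.real {0} * ∫ z, |z| ^ q ∂stdGaussian
  have hq0 : 0 < q := by linarith
  have hpos : ∀ᶠ σ in nhdsWithin (0:ℝ) (Ioi 0), 0 < σ ^ (2 * q - 2) := by
    filter_upwards [self_mem_nhdsWithin] with σ hs using rpow_pos_of_pos hs _
  have hs0 : Tendsto (fun σ : ℝ => σ ^ (2 * q - 2)) (nhdsWithin (0:ℝ) (Ioi 0)) (nhds 0) := by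
    have := (continuous_rpow_const (by linarith : 0 ≤ 2 * q - 2)).tendsto (0:ℝ)
    rw [zero_rpow (by linarith)] at this
    exact this.mono_left nhdsWithin_le_nhds
  have hχ0 : Tendsto χ (nhdsWithin (0:ℝ) (Ioi 0)) (nhds 0) := by
    refine tendsto_order.2 ⟨fun a ha => ?_, fun a ha => ?_⟩
    · filter_upwards [hχ] with σ h using ha.trans_le h.1
    · set δ := min a 1
      have hδ : 0 < δ := lt_min ha one_pos
      have hlim := tendsto_integral_signedPow_prox_sq hq1 hq2 hη hμ (χ := fun _ => δ)
        (Eventually.of_forall fun _ => ⟨hδ.le, min_le_right _ _⟩)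
      have h2 := (hs0.const_mul 4).sub (hlim.const_mul ((δ * q) ^ 2))
      have hneg : 4 * 0 - (δ * q) ^ 2 * M < 0 := by
        have : 0 < (δ * q) ^ 2 * M := by positivity
        linarith
      filter_upwards [hχ, hpos, h2.eventually_lt_const hneg] with σ h hs hlt
      by_contra! hle
      have hR : Rq η μ (χ σ) σ ≤ 1 := by
        have := h.2 0 le_rfl
        rw [Rq_eq hq1 hq2 hη hμ le_rfl (χ := 0)] at this
        simpa using this
      have h4 := mul_integral_signedPow_prox_sq_le hq1 hq2 hη hμ hδ.le
        ((min_le_left a 1).trans hle) hR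
      have := mul_le_mul_of_nonneg_left h4 hs.le
      linarith
  set B : (ℝ → ℝ) → ℝ → ℝ := fun f σ => σ ^ (2 * q - 2) *
    ∫ p, signedPow (q - 1) (η (p.1 / σ + p.2) (f σ)) ^ 2 ∂(μ.prod stdGaussian)
  set A : (ℝ → ℝ) → ℝ → ℝ := fun f σ =>
    ∫ p, p.2 * signedPow (q - 1) (η (p.1 / σ + p.2) (f σ)) ∂(μ.prod stdGaussian)
  have hform : ∀ f : ℝ → ℝ, ∀ σ, 0 < σ ^ (2 * q - 2) → 0 ≤ f σ →
      (Rq η μ (f σ) σ - 1) / σ ^ (2 * q - 2)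
        = (f σ * q / σ ^ (2 * q - 2)) ^ 2 * B f σ
          - 2 * (f σ * q / σ ^ (2 * q - 2)) * A f σ := by
    intro f σ hs hf
    rw [Rq_eq hq1 hq2 hη hμ hf]
    simp only [A, B]
    field_simp
    ring
  have hB : ∀ f : ℝ → ℝ, (∀ᶠ σ in nhdsWithin (0:ℝ) (Ioi 0), 0 ≤ f σ) →
      Tendsto f (nhdsWithin (0:ℝ) (Ioi 0)) (nhds 0) →
      Tendsto (B f) (nhdsWithin (0:ℝ) (Ioi 0)) (nhds M) := fun f hf hf0 =>
    tendsto_integral_signedPow_prox_sq hq1 hq2 hη hμ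
      (hf.and ((hf0.eventually_lt_const one_pos).mono fun _ h => h.le))
  have hA : ∀ f : ℝ → ℝ, (∀ᶠ σ in nhdsWithin (0:ℝ) (Ioi 0), 0 ≤ f σ) →
      Tendsto f (nhdsWithin (0:ℝ) (Ioi 0)) (nhds 0) →
      Tendsto (A f) (nhdsWithin (0:ℝ) (Ioi 0)) (nhds m) := fun f hf hf0 =>
    tendsto_integral_snd_mul_signedPow_prox hq1 hq2 hη hμ hf hf0
  have hm : 0 ≤ m :=
    mul_nonneg measureReal_nonneg (integral_nonneg fun z => rpow_nonneg (abs_nonneg _) _)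
  set f : ℝ → ℝ := fun σ => m / (q * M) * σ ^ (2 * q - 2)
  have hf : ∀ᶠ σ in nhdsWithin (0:ℝ) (Ioi 0), 0 ≤ f σ := by
    filter_upwards [hpos] with σ hs
    positivity
  have hf0 : Tendsto f (nhdsWithin (0:ℝ) (Ioi 0)) (nhds 0) := by
    simpa using hs0.const_mul (m / (q * M))
  have hχn : ∀ᶠ σ in nhdsWithin (0:ℝ) (Ioi 0), 0 ≤ χ σ := hχ.mono fun _ h => h.1
  have hlow : Tendsto (fun σ => -(A χ σ ^ 2 / B χ σ)) (nhdsWithin (0:ℝ) (Ioi 0))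
      (nhds (-(m ^ 2 / M))) :=
    (((hA χ hχn hχ0).pow 2).div (hB χ hχn hχ0) hM.ne').neg
  have hup : Tendsto (fun σ => (m / M) ^ 2 * B f σ - 2 * (m / M) * A f σ)
      (nhdsWithin (0:ℝ) (Ioi 0)) (nhds (-(m ^ 2 / M))) := by
    have := ((hB f hf hf0).const_mul ((m / M) ^ 2)).sub
      ((hA f hf hf0).const_mul (2 * (m / M)))
    convert this using 2
    field_simp
    ring
  refine tendsto_of_tendsto_of_tendsto_of_le_of_le' hlow hup ?_ ?_
  · filter_upwards [hpos, hχn, (hB χ hχn hχ0).eventually_const_lt hM] with σ hs h hBpos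
    rw [hform χ σ hs h, neg_le_iff_add_nonneg]
    generalize χ σ * q / σ ^ (2 * q - 2) = x
    have : x ^ 2 * B χ σ - 2 * x * A χ σ + A χ σ ^ 2 / B χ σ
        = (x * B χ σ - A χ σ) ^ 2 / B χ σ := by
      field_simp
      ring
    rw [this]
    positivity
  · filter_upwards [hpos, hχ, hf] with σ hs h hfσ
    have e : f σ * q / σ ^ (2 * q - 2) = m / M := by
      rw [div_eq_iff hs.ne']
      simp only [f]
      field_simp
    have h1 := hform f σ hs hfσ
    rw [e] at h1
    rw [← h1]
    have := h.2 (f σ) hfσ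
    gcongr

end Risk

section Mixture

variable {ε : ℝ} {g : Measure ℝ}

theorem isProbabilityMeasure_mix [IsProbabilityMeasure g] (hε : ε ∈ Ioo (0:ℝ) 1) : IsProbabilityMeasure (mix ε g) := by
  refine ⟨?_⟩
  simp only [mix, Measure.add_apply, Measure.smul_apply, measure_univ, smul_eq_mul, mul_one]
  rw [← ENNReal.ofReal_add (by linarith [hε.2]) hε.1.le]
  simp

theorem integrable_mix {f : ℝ → ℝ} (hf : Integrable f g) : Integrable f (mix ε g) :=
  ((integrable_dirac (by simp)).smul_measure ENNReal.ofReal_ne_top).add_measure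
    (hf.smul_measure ENNReal.ofReal_ne_top)

theorem integral_mix (hε : ε ∈ Ioo (0:ℝ) 1) {f : ℝ → ℝ} (hf : Integrable f g) :
    ∫ x, f x ∂(mix ε g) = (1 - ε) * f 0 + ε * ∫ x, f x ∂g := by
  unfold mix
  rw [integral_add_measure ((integrable_dirac (by simp)).smul_measure ENNReal.ofReal_ne_top)
    (hf.smul_measure ENNReal.ofReal_ne_top), integral_smul_measure, integral_smul_measure,
    integral_dirac, ENNReal.toReal_ofReal (by linarith [hε.2]), ENNReal.toReal_ofReal hε.1.le]
  simp

theorem mix_real_singleton_zero (hε : ε ∈ Ioo (0:ℝ) 1) (hg0 : g {0} = 0) :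
    (mix ε g).real {0} = 1 - ε := by
  simp [Measure.real, mix, hg0, ENNReal.toReal_ofReal (by linarith [hε.2] : 0 ≤ 1 - ε)]

theorem integrable_abs_rpow [IsProbabilityMeasure g] {s : ℝ} (hs0 : 0 ≤ s) (hs2 : s ≤ 2)
    (hG2 : Integrable (fun x : ℝ => x ^ 2) g) : Integrable (fun x : ℝ => |x| ^ s) g := by
  refine ((integrable_const (1:ℝ)).add hG2).mono'
    (continuous_abs.rpow_const fun _ => Or.inr hs0).aestronglyMeasurable
    (Eventually.of_forall fun x => ?_)
  rw [Real.norm_eq_abs, abs_of_nonneg (rpow_nonneg (abs_nonneg _) _)]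
  simpa using rpow_le_one_add_sq (abs_nonneg x) hs0 hs2

theorem integral_abs_rpow_pos [IsProbabilityMeasure g] {s : ℝ} (hs0 : 0 ≤ s) (hs2 : s ≤ 2)
    (hG2 : Integrable (fun x : ℝ => x ^ 2) g) (hg0 : g {0} = 0) : 0 < ∫ x, |x| ^ s ∂g := by
  rw [integral_pos_iff_support_of_nonneg (fun x => rpow_nonneg (abs_nonneg _) _)
    (integrable_abs_rpow hs0 hs2 hG2)]
  have hsub : ({0} : Set ℝ)ᶜ ⊆ Function.support fun x : ℝ => |x| ^ s := fun x hx =>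
    (rpow_pos_of_pos (abs_pos.2 hx) _).ne'
  refine lt_of_lt_of_le ?_ (measure_mono hsub)
  rw [prob_compl_eq_one_sub (measurableSet_singleton 0), hg0]
  simp

end Mixture

/-- If `P(|G| ≤ t) = O(t)` as `t → 0` and `E[G²] < ∞`, then for `q ∈ (1,2)`:
`(R_q(χ*_q(σ),σ) − 1)/σ^{2q−2} → −(1−ε)²(E|Z|^q)²/(ε·E|G|^{2q−2})` as `σ → 0⁺`, where
`χ*_q(σ)` is the smallest minimizer of `χ ↦ R_q(χ,σ)` over `[0,∞)` (exists for small `σ`). -/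
theorem risk_q_rate
    (q ε : ℝ) (hq1 : 1 < q) (hq2 : q < 2) (hε : ε ∈ Ioo (0:ℝ) 1)
    (g : Measure ℝ) [IsProbabilityMeasure g] (hg0 : g {0} = 0)
    (hG2 : Integrable (fun x => x^2) g)
    (hGsmall : (fun t => (g {x : ℝ | |x| ≤ t}).toReal)
      =O[nhdsWithin (0:ℝ) (Ioi 0)] (fun t => t))
    (η : ℝ → ℝ → ℝ) (hη : ∀ u χ, 0 ≤ χ → IsProx q χ u (η u χ))
    (χstar : ℝ → ℝ)
    (hχstar : ∀ᶠ σ in nhdsWithin (0:ℝ) (Ioi 0),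
      χstar σ ∈ Ici (0:ℝ) ∧
      IsMinOn (fun χ => Rq η (mix ε g) χ σ) (Ici 0) (χstar σ) ∧
      ∀ χ' ∈ Ici (0:ℝ), IsMinOn (fun χ => Rq η (mix ε g) χ σ) (Ici 0) χ' → χstar σ ≤ χ') :
    Tendsto (fun σ => (Rq η (mix ε g) (χstar σ) σ - 1) / σ ^ (2*q - 2))
      (nhdsWithin (0:ℝ) (Ioi 0))
      (nhds (-((1 - ε)^2 * (∫ z, |z| ^ q ∂stdGaussian)^2 /
        (ε * ∫ x, |x| ^ (2*q - 2) ∂g)))) := by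
  have := isProbabilityMeasure_mix (g := g) hε
  have hs0 : 0 ≤ 2 * q - 2 := by linarith
  have hs2 : 2 * q - 2 ≤ 2 := by linarith
  have hM : ∫ x, |x| ^ (2 * q - 2) ∂(mix ε g) = ε * ∫ x, |x| ^ (2 * q - 2) ∂g := by
    rw [integral_mix hε (integrable_abs_rpow hs0 hs2 hG2), abs_zero,
      zero_rpow (by linarith)]
    ring
  have h := tendsto_Rq_sub_one_div hq1 hq2 hη (integrable_mix (ε := ε) hG2)
    (by rw [hM]; exact mul_pos hε.1 (integral_abs_rpow_pos hs0 hs2 hG2 hg0)) (χ := χstar)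
    (hχstar.mono fun σ hσ => ⟨hσ.1, fun c hc => hσ.2.1 hc⟩)
  rwa [hM, mix_real_singleton_zero hε hg0, mul_pow] at h
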